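/- arXiv:1806.03475 — 4 statements merged into one kernel-verified Lean document; each statement's English description precedes it below -/
import Mathlib

section
/- Let A be an n×n complex matrix and B an n×l complex matrix. Then (A,B) is controllable if and only if for every eigenvalue λ of A and every left eigenbasis X of A associated with λ (an n×k matrix where k is the geometric multiplicity of λ), the k×l matrix XᵀB has rank k (full row rank). -/
open Matrix

noncomputable section

/-- The controllability matrix `[B, AB, A²B, …, A^{n-1}B]`, as an `n × (n·l)` matrix. -/
def ctrbMat {R : Type} [CommRing R] {n l : ℕ} (A : Matrix (Fin n) (Fin n) R)
    (B : Matrix (Fin n) (Fin l) R) : Matrix (Fin n) (Fin n × Fin l) R :=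
  Matrix.of fun i jk => (A ^ (jk.1 : ℕ) * B) i jk.2

/-- `(A, B)` is controllable iff the controllability matrix has rank `n`. -/
def Controllable {R : Type} [CommRing R] {n l : ℕ} (A : Matrix (Fin n) (Fin n) R)
    (B : Matrix (Fin n) (Fin l) R) : Prop :=
  (ctrbMat A B).rank = n

/-- The columns of a matrix, as vectors. -/
def matCols {R : Type} [CommRing R] {n k : ℕ} (X : Matrix (Fin n) (Fin k) R) :
    Fin k → (Fin n → R) := fun j i => X i j

/-- `X` is an `n × k` matrix whose columns are a basis of the λ-eigenspace of `Aᵀ`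
(equivalently, its columns are `k` linearly independent left eigenvectors of `A`
for `μ`, spanning the whole left eigenspace; in particular `k` is the geometric
multiplicity of `μ`). -/
def IsLeftEigenbasis {n k : ℕ} (A : Matrix (Fin n) (Fin n) ℂ) (μ : ℂ)
    (X : Matrix (Fin n) (Fin k) ℂ) : Prop :=
  LinearIndependent ℂ (matCols X) ∧
  (∀ j, A.transpose.mulVec (matCols X j) = μ • matCols X j) ∧
  (∀ v : Fin n → ℂ, A.transpose.mulVec v = μ • v →
      v ∈ Submodule.span ℂ (Set.range (matCols X)))

/-- The submatrix of `M` consisting of the columns indexed by `S`. -/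
def colSub {R : Type} [CommRing R] {m n : ℕ} (M : Matrix (Fin m) (Fin n) R)
    (S : Finset (Fin n)) : Matrix (Fin m) {x // x ∈ S} R :=
  M.submatrix id (fun j => (j : Fin n))

/-- `H = {J ⊆ {1,…,n} : |J| = k and the k×k submatrix of Xᵀ formed by the columns
indexed by J is invertible}` (invertibility of the square submatrix is expressed
as full rank `k`). -/
def Hset {n k : ℕ} (X : Matrix (Fin n) (Fin k) ℂ) : Set (Finset (Fin n)) :=
  {J | J.card = k ∧ (colSub X.transpose J).rank = k}

/-- The diagonal 0/1 matrix `I_S` selecting the states in `S`. -/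
def diagSel {n : ℕ} (S : Finset (Fin n)) : Matrix (Fin n) (Fin n) ℝ :=
  Matrix.diagonal (fun j => if j ∈ S then (1 : ℝ) else 0)

/-- `‖B‖₀`, the number of nonzero entries of `B`. -/
def sparsity {n l : ℕ} (B : Matrix (Fin n) (Fin l) ℝ) : ℕ :=
  (Finset.univ.filter fun jc : Fin n × Fin l => B jc.1 jc.2 ≠ 0).card

/-- The MACP optimum: the minimal cardinality of a set `S` of actuated states
such that `(A, I_S)` is controllable. -/
def MACPopt {n : ℕ} (A : Matrix (Fin n) (Fin n) ℝ) : ℕ :=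
  sInf {m | ∃ S : Finset (Fin n), Controllable A (diagSel S) ∧ S.card = m}

/-- The `l`-MSCP optimum: the minimal number of nonzero entries of an `n × l`
real matrix `B` such that `(A, B)` is controllable. -/
def MSCPopt {n : ℕ} (A : Matrix (Fin n) (Fin n) ℝ) (l : ℕ) : ℕ :=
  sInf {m | ∃ B : Matrix (Fin n) (Fin l) ℝ, Controllable A B ∧ sparsity B = m}

/-- A matrix over a field has full row rank iff its left kernel is trivial. -/
theorem Matrix.rank_eq_card_iff_vecMul {K m n : Type*} [Field K] [Fintype m] [Fintype n]
    (M : Matrix m n K) :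
    M.rank = Fintype.card m ↔ ∀ v : m → K, v ᵥ* M = 0 → v = 0 := by
  rw [M.rank_eq_finrank_span_row, eq_comm]
  change _ = Set.finrank K (Set.range M.row) ↔ _
  rw [← linearIndependent_iff_card_eq_finrank_span, ← Matrix.vecMul_injective_iff]
  exact injective_iff_map_eq_zero M.vecMulLinear

theorem controllable_iff_vecMul {n l : ℕ} (A : Matrix (Fin n) (Fin n) ℂ)
    (B : Matrix (Fin n) (Fin l) ℂ) :
    Controllable A B ↔
      ∀ v : Fin n → ℂ, (∀ i < n, v ᵥ* (A ^ i * B) = 0) → v = 0 := by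
  have h := (ctrbMat A B).rank_eq_card_iff_vecMul
  rw [Fintype.card_fin] at h
  rw [Controllable, h]
  refine forall_congr' fun v => imp_congr_left ?_
  constructor
  · intro hv i hi
    ext j
    exact congrFun hv (⟨i, hi⟩, j)
  · intro hv
    ext ⟨i, j⟩
    exact congrFun (hv i i.2) j

theorem vecMul_pow_mul_eq_zero {n l : ℕ} {A : Matrix (Fin n) (Fin n) ℂ}
    {B : Matrix (Fin n) (Fin l) ℂ} {v : Fin n → ℂ}
    (h : ∀ i < n, v ᵥ* (A ^ i * B) = 0) (i : ℕ) : v ᵥ* (A ^ i * B) = 0 := by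
  rcases Nat.eq_zero_or_pos n with rfl | hn
  · rw [Subsingleton.elim v 0, Matrix.zero_vecMul]
  have hdeg : (Polynomial.X ^ i %ₘ A.charpoly).natDegree < n := by
    have := Polynomial.natDegree_modByMonic_lt (Polynomial.X ^ i) A.charpoly_monic (by
      intro h1
      have := A.charpoly_natDegree_eq_dim
      simp [h1] at this
      omega)
    simpa using this
  rw [A.pow_eq_aeval_mod_charpoly, Polynomial.aeval_eq_sum_range' hdeg, Matrix.sum_mul,
    Matrix.vecMul_sum]
  refine Finset.sum_eq_zero fun j hj => ?_
  rw [Matrix.smul_mul, Matrix.vecMul_smul, h j (Finset.mem_range.1 hj), smul_zero]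

/-- The Popov–Belevitch–Hautus eigenvector test. -/
theorem controllable_iff_eigenvector {n l : ℕ} (A : Matrix (Fin n) (Fin n) ℂ)
    (B : Matrix (Fin n) (Fin l) ℂ) :
    Controllable A B ↔
      ∀ (μ : ℂ) (v : Fin n → ℂ), v ᵥ* A = μ • v → v ᵥ* B = 0 → v = 0 := by
  rw [controllable_iff_vecMul]
  constructor
  · intro h μ v hA hB
    refine h v fun i _ => ?_
    have hpow : v ᵥ* A ^ i = μ ^ i • v := by
      induction i with
      | zero => simp
      | succ i ih => rw [pow_succ, ← Matrix.vecMul_vecMul, ih (by omega), Matrix.smul_vecMul, hA,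
          smul_smul, pow_succ]
    rw [← Matrix.vecMul_vecMul, hpow, Matrix.smul_vecMul, hB, smul_zero]
  · intro h v hv
    let W : Submodule ℂ (Fin n → ℂ) := ⨅ i : ℕ, LinearMap.ker (A ^ i * B).vecMulLinear
    have mem_W (w : Fin n → ℂ) : w ∈ W ↔ ∀ i, w ᵥ* (A ^ i * B) = 0 := by
      simp [W, Submodule.mem_iInf]
    have hW : ∀ w ∈ W, A.vecMulLinear w ∈ W := by
      intro w hw
      rw [mem_W] at hw ⊢
      intro i
      rw [Matrix.vecMulLinear_apply, Matrix.vecMul_vecMul, ← Matrix.mul_assoc, ← pow_succ']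
      exact hw (i + 1)
    by_contra hne
    have : Nontrivial W :=
      ⟨⟨v, (mem_W v).2 (vecMul_pow_mul_eq_zero hv)⟩, 0, fun h0 => hne (congrArg Subtype.val h0)⟩
    obtain ⟨μ, hμ⟩ := Module.End.exists_eigenvalue (A.vecMulLinear.restrict hW)
    obtain ⟨w, hw⟩ := hμ.exists_hasEigenvector
    refine hw.2 (Subtype.ext (h μ w (congrArg Subtype.val hw.apply_eq_smul) ?_))
    simpa using (mem_W w).1 w.2 0

theorem mem_spectrum_of_vecMul {n : ℕ} {A : Matrix (Fin n) (Fin n) ℂ} {μ : ℂ} {v : Fin n → ℂ}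
    (hv : v ≠ 0) (h : v ᵥ* A = μ • v) : μ ∈ spectrum ℂ A := by
  rw [spectrum.mem_iff]
  intro hu
  refine hv (Matrix.vecMul_injective_of_isUnit hu ?_)
  simp [Matrix.vecMul_sub, h, Algebra.algebraMap_eq_smul_one, Matrix.vecMul_smul]

theorem exists_isLeftEigenbasis {n : ℕ} (A : Matrix (Fin n) (Fin n) ℂ) (μ : ℂ) :
    ∃ (k : ℕ) (X : Matrix (Fin n) (Fin k) ℂ), IsLeftEigenbasis A μ X := by
  let E := Module.End.eigenspace Aᵀ.mulVecLin μ
  let b := Module.finBasis ℂ E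
  refine ⟨_, Matrix.of fun i j => (b j : Fin n → ℂ) i, ?_, fun j => ?_, fun v hv => ?_⟩
  · exact b.linearIndependent.map' E.subtype E.ker_subtype
  · exact Module.End.mem_eigenspace_iff.1 (b j).2
  · have hvE : v ∈ E := Module.End.mem_eigenspace_iff.2 hv
    have := Submodule.mem_map_of_mem (f := E.subtype) (b.mem_span ⟨v, hvE⟩)
    rw [Submodule.map_span, ← Set.range_comp] at this
    exact this

theorem statement_0 {n l : ℕ} (A : Matrix (Fin n) (Fin n) ℂ)
    (B : Matrix (Fin n) (Fin l) ℂ) :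
    Controllable A B ↔
      ∀ μ ∈ spectrum ℂ A, ∀ (k : ℕ) (X : Matrix (Fin n) (Fin k) ℂ),
        IsLeftEigenbasis A μ X → (X.transpose * B).rank = k := by
  rw [controllable_iff_eigenvector]
  constructor
  · rintro h μ - k X ⟨hli, heig, -⟩
    have hrank := (Xᵀ * B).rank_eq_card_iff_vecMul
    rw [Fintype.card_fin] at hrank
    refine hrank.2 fun w hw => ?_
    rw [← Matrix.vecMul_vecMul] at hw
    have hAX : Aᵀ * X = μ • X := by
      ext i j
      exact congrFun (heig j) i
    have h0 := h μ (w ᵥ* Xᵀ) (by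
      rw [Matrix.vecMul_transpose, ← Matrix.mulVec_transpose, Matrix.mulVec_mulVec, hAX,
        Matrix.smul_mulVec]) hw
    rw [Matrix.vecMul_transpose] at h0
    refine Matrix.mulVec_injective_iff.2 hli ?_
    rw [h0, Matrix.mulVec_zero]
  · intro h μ v hA hB
    by_contra hv
    obtain ⟨k, X, hX⟩ := exists_isLeftEigenbasis A μ
    have hrank := (Xᵀ * B).rank_eq_card_iff_vecMul
    rw [Fintype.card_fin] at hrank
    have hspan := hX.2.2 v (by rw [Matrix.mulVec_transpose, hA])
    have hrange : v ∈ LinearMap.range X.mulVecLin := by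
      rw [Matrix.range_mulVecLin]
      exact hspan
    obtain ⟨w, rfl⟩ := hrange
    rw [Matrix.mulVecLin_apply] at hB hv
    refine hv ?_
    rw [hrank.1 (h μ (mem_spectrum_of_vecMul hv hA) k X hX) w (by
      rw [← Matrix.vecMul_vecMul, Matrix.vecMul_transpose, hB]), Matrix.mulVec_zero]
end
end

section
/- Let m ≤ n and let P ⊆ {1,…,m}×{1,…,n} be a sparsity pattern. Then there exists a real m×n matrix M with M_{ij} = 0 whenever (i,j) ∉ P and rank(M) = m (full row rank), if and only if there exists an injective function σ : {1,…,m} → {1,…,n} such that (i, σ(i)) ∈ P for every i ∈ {1,…,m}. -/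
open Matrix

noncomputable section

/-- If `det (M * N) ≠ 0`, then the rows of `M` admit a transversal through nonzero entries. -/
theorem exists_injective_ne_zero_of_det_mul_ne_zero {ι κ R : Type*} [Fintype ι] [DecidableEq ι]
    [Fintype κ] [CommRing R] (M : Matrix ι κ R) (N : Matrix κ ι R) (h : (M * N).det ≠ 0) :
    ∃ σ : ι → κ, Function.Injective σ ∧ ∀ i, M i (σ i) ≠ 0 := by
  classical
  have hMN : M * N = fun i => ∑ j, M i j • N j := by
    ext i k
    simp [Matrix.mul_apply, Finset.sum_apply]
  have hexp : (M * N).det = ∑ p : ι → κ, (∏ i, M i (p i)) • (N.submatrix p id).det := by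
    rw [hMN]
    change (Matrix.detRowAlternating (R := R) (n := ι)).toMultilinearMap _ = _
    rw [MultilinearMap.map_sum]
    exact Finset.sum_congr rfl fun p _ => MultilinearMap.map_smul_univ _ _ _
  rw [hexp] at h
  obtain ⟨p, -, hp⟩ := Finset.exists_ne_zero_of_sum_ne_zero h
  refine ⟨p, fun i k hik => ?_, fun i hi => hp ?_⟩
  · by_contra hne
    refine hp ?_
    rw [Matrix.det_zero_of_row_eq hne (by ext; simp [hik]), smul_zero]
  · rw [Finset.prod_eq_zero (Finset.mem_univ i) hi, zero_smul]

theorem statement_4 {m n : ℕ} (hmn : m ≤ n) (P : Set (Fin m × Fin n)) :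
    (∃ M : Matrix (Fin m) (Fin n) ℝ,
        (∀ i j, (i, j) ∉ P → M i j = 0) ∧ M.rank = m) ↔
      ∃ σ : Fin m → Fin n, Function.Injective σ ∧ ∀ i, (i, σ i) ∈ P := by
  constructor
  · rintro ⟨M, hM, hr⟩
    have hdet : (M * Mᵀ).det ≠ 0 := by
      have hu : IsUnit (M * Mᵀ) := by
        rw [← Matrix.linearIndependent_rows_iff_isUnit,
          linearIndependent_iff_card_eq_finrank_span, Set.finrank,
          ← Matrix.rank_eq_finrank_span_row, Matrix.rank_self_mul_transpose, hr,
          Fintype.card_fin]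
      exact ((Matrix.isUnit_iff_isUnit_det _).1 hu).ne_zero
    obtain ⟨σ, hσ, hne⟩ := exists_injective_ne_zero_of_det_mul_ne_zero M Mᵀ hdet
    exact ⟨σ, hσ, fun i => by_contra fun hi => hne i (hM i _ hi)⟩
  · rintro ⟨σ, hσ, hP⟩
    refine ⟨Matrix.of fun i j => if j = σ i then 1 else 0, fun i j hij => ?_, ?_⟩
    · have : j ≠ σ i := by
        rintro rfl
        exact hij (hP i)
      simp [this]
    · have hone : (Matrix.of fun i j => if j = σ i then (1 : ℝ) else 0) *
          (Matrix.of fun i j => if j = σ i then (1 : ℝ) else 0)ᵀ = 1 := by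
        ext i k
        simp [Matrix.mul_apply, Matrix.one_apply, hσ.eq_iff, eq_comm]
      rw [← Matrix.rank_self_mul_transpose, hone, Matrix.rank_one, Fintype.card_fin]
end
end

section
/- Let A be an n×n real matrix with p distinct (complex) eigenvalues λ_1,…,λ_p, where λ_i has geometric multiplicity k_i and left eigenbasis X_i, and let 𝒳_a ⊆ {1,…,n} be a set of accessible states. If there exists a real n×l matrix B with every nonzero row of B having its index in 𝒳_a such that (A,B) is controllable, then for every i ∈ {1,…,p} there exists h_i ∈ H_i with h_i ⊆ 𝒳_a. -/
open Matrix

noncomputable section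

/-- A matrix over a field whose rank is its number of rows has a right inverse. -/
theorem exists_mul_eq_one_of_rank_eq {K : Type} [Field K] {n : ℕ} {ι : Type} [Fintype ι]
    (M : Matrix (Fin n) ι K) (h : M.rank = n) : ∃ N : Matrix ι (Fin n) K, M * N = 1 := by
  classical
  have hr : LinearMap.range M.mulVecLin = ⊤ := by
    apply Submodule.eq_top_of_finrank_eq
    rw [Module.finrank_fin_fun]
    exact h
  have hs : ∀ w, ∃ v, M *ᵥ v = w := fun w => LinearMap.range_eq_top.1 hr w
  choose g hg using hs
  refine ⟨Matrix.of fun i j => g (Pi.single j 1) i, ?_⟩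
  ext i j
  have := congrFun (hg (Pi.single j 1)) i
  simp only [mulVec, dotProduct] at this
  simp only [mul_apply, of_apply, this, one_apply, Pi.single_apply]

theorem vecMul_pow_of_vecMul_eq_smul {n : ℕ} {A : Matrix (Fin n) (Fin n) ℂ} {v : Fin n → ℂ}
    {μ : ℂ} (h : v ᵥ* A = μ • v) (m : ℕ) : v ᵥ* A ^ m = μ ^ m • v := by
  induction m with
  | zero => simp
  | succ m ih => rw [pow_succ, ← vecMul_vecMul, ih, smul_vecMul, h, smul_smul, ← pow_succ]

/-- The easy half of the Popov–Belevitch–Hautus test: no complex left eigenvector of `A`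
annihilates `B` when the real pair `(A, B)` is controllable. -/
theorem Controllable.eq_zero_of_vecMul {n l : ℕ} {A : Matrix (Fin n) (Fin n) ℝ}
    {B : Matrix (Fin n) (Fin l) ℝ} (hAB : Controllable A B) {v : Fin n → ℂ} {μ : ℂ}
    (hA : v ᵥ* A.map Complex.ofReal = μ • v) (hB : v ᵥ* B.map Complex.ofReal = 0) : v = 0 := by
  obtain ⟨N, hN⟩ := exists_mul_eq_one_of_rank_eq _ hAB
  have hC : v ᵥ* (ctrbMat A B).map Complex.ofRealHom = 0 := by
    ext ⟨m, c⟩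
    have h1 : v ᵥ* ((A ^ (m : ℕ) * B).map Complex.ofRealHom) = 0 := by
      rw [Matrix.map_mul, Matrix.map_pow, ← vecMul_vecMul]
      erw [vecMul_pow_of_vecMul_eq_smul hA, smul_vecMul, hB]
      simp
    exact congrFun h1 c
  have h1 := congrArg (fun M => M.map Complex.ofRealHom) hN
  simp only [Matrix.map_mul] at h1
  rw [Matrix.map_one _ (map_zero _) (map_one _)] at h1
  rw [← vecMul_one v, ← h1, ← vecMul_vecMul, hC, zero_vecMul]

/-- If no nonzero combination of the columns of `X` vanishes on `S`, the rows of `X` indexed by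
`S` span. -/
theorem span_rows_eq_top {n k : ℕ} (X : Matrix (Fin n) (Fin k) ℂ) (S : Set (Fin n))
    (h : ∀ c : Fin k → ℂ, (∀ j ∈ S, (X *ᵥ c) j = 0) → c = 0) :
    Submodule.span ℂ (Set.range fun j : S => X j) = ⊤ := by
  by_contra hne
  obtain ⟨f, hf, hle⟩ := Submodule.exists_le_ker_of_lt_top _ (lt_top_iff_ne_top.2 hne)
  have hc := h (fun i => f fun j => if i = j then 1 else 0) fun j hj => by
    have : f (X j) = 0 := hle (Submodule.subset_span ⟨⟨j, hj⟩, rfl⟩)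
    rw [LinearMap.pi_apply_eq_sum_univ] at this
    simpa [mulVec, dotProduct] using this
  apply hf
  refine LinearMap.ext fun x => ?_
  rw [LinearMap.pi_apply_eq_sum_univ f]
  exact Finset.sum_eq_zero fun i _ => by rw [congrFun hc i, Pi.zero_apply, smul_zero]

/-- If the rows of `X` indexed by `S` span, then some `J ⊆ S` selects an invertible submatrix. -/
theorem exists_mem_Hset_of_span_rows {n k : ℕ} (X : Matrix (Fin n) (Fin k) ℂ) (S : Set (Fin n))
    (h : Submodule.span ℂ (Set.range fun j : S => X j) = ⊤) :
    ∃ J ∈ Hset X, (J : Set (Fin n)) ⊆ S := by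
  classical
  obtain ⟨κ, a, ha, hspan, hli⟩ := exists_linearIndependent' ℂ (fun j : S => X j)
  rw [h] at hspan
  have : Finite κ := Finite.of_injective a ha
  have := Fintype.ofFinite κ
  have hcard : Fintype.card κ = k := by
    rw [← finrank_span_eq_card hli, hspan, finrank_top, Module.finrank_fin_fun]
  refine ⟨Finset.univ.image (Subtype.val ∘ a), ⟨?_, ?_⟩, ?_⟩
  · rw [Finset.card_image_of_injective _ (Subtype.val_injective.comp ha), Finset.card_univ, hcard]
  · rw [rank_eq_finrank_span_cols, eq_top_iff.2 (hspan.symm.le.trans (Submodule.span_mono ?_)),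
      finrank_top, Module.finrank_fin_fun]
    rintro _ ⟨x, rfl⟩
    exact ⟨⟨a x, Finset.mem_image_of_mem _ (Finset.mem_univ x)⟩, rfl⟩
  · intro j hj
    obtain ⟨x, -, rfl⟩ := Finset.mem_image.1 (Finset.mem_coe.1 hj)
    exact (a x).2

theorem statement_6 {n l p : ℕ} (A : Matrix (Fin n) (Fin n) ℝ)
    (μ : Fin p → ℂ) (hμ : Function.Injective μ)
    (hspec : spectrum ℂ (A.map Complex.ofReal) = Set.range μ)
    (k : Fin p → ℕ) (X : ∀ i, Matrix (Fin n) (Fin (k i)) ℂ)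
    (hX : ∀ i, IsLeftEigenbasis (A.map Complex.ofReal) (μ i) (X i))
    (Xa : Set (Fin n))
    (hB : ∃ B : Matrix (Fin n) (Fin l) ℝ,
        (∀ j, (∃ c, B j c ≠ 0) → j ∈ Xa) ∧ Controllable A B) :
    ∀ i, ∃ h ∈ Hset (X i), (↑h : Set (Fin n)) ⊆ Xa := by
  obtain ⟨B, hBXa, hAB⟩ := hB
  intro i
  obtain ⟨hli, heig, -⟩ := hX i
  refine exists_mem_Hset_of_span_rows _ _ (span_rows_eq_top _ _ fun c hc => ?_)
  have hcomb : X i *ᵥ c = ∑ m, c m • matCols (X i) m := by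
    ext j
    simp [mulVec, dotProduct, matCols, mul_comm]
  have hv : X i *ᵥ c = 0 := by
    refine hAB.eq_zero_of_vecMul (μ := μ i) ?_ ?_
    · rw [← mulVec_transpose, hcomb, mulVec_sum, Finset.smul_sum]
      refine Finset.sum_congr rfl fun m _ => ?_
      rw [mulVec_smul, heig, smul_comm]
    · ext b
      simp only [vecMul, dotProduct, map_apply, Pi.zero_apply]
      refine Finset.sum_eq_zero fun j _ => ?_
      by_cases hj : j ∈ Xa
      · simp [hc j hj]
      · have : B j b = 0 := by_contra fun hne => hj (hBXa j ⟨b, hne⟩)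
        simp [this]
  ext m
  exact Fintype.linearIndependent_iff.1 hli c (hcomb ▸ hv) m
end
end

section
/- Let X be an n×k complex matrix of rank k, and let H = {J ⊆ {1,…,n} : |J| = k and the k×k submatrix of Xᵀ formed by the columns indexed by J is invertible}. Then for every S ⊆ {1,…,n}, the maximum of |S ∩ h| over h ∈ H equals the rank of the submatrix of Xᵀ consisting of the columns indexed by S. -/
open Matrix

noncomputable section

theorem rank_colSub_eq_finrank_span_image {m n : ℕ} (M : Matrix (Fin m) (Fin n) ℂ)
    (S : Finset (Fin n)) :
    (colSub M S).rank = Module.finrank ℂ (Submodule.span ℂ (M.col '' S)) := by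
  rw [Matrix.rank_eq_finrank_span_cols, Set.image_eq_range]
  rfl

theorem linearIndepOn_col_iff_rank_colSub_eq_card {m n : ℕ} (M : Matrix (Fin m) (Fin n) ℂ)
    (S : Finset (Fin n)) :
    LinearIndepOn ℂ M.col (S : Set (Fin n)) ↔ (colSub M S).rank = S.card := by
  rw [rank_colSub_eq_finrank_span_image, Set.image_eq_range, LinearIndepOn,
    linearIndependent_iff_card_eq_finrank_span, Set.finrank]
  simp [eq_comm]

theorem rank_colSub_mono {m n : ℕ} (M : Matrix (Fin m) (Fin n) ℂ) {S T : Finset (Fin n)}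
    (h : S ⊆ T) : (colSub M S).rank ≤ (colSub M T).rank := by
  simp only [rank_colSub_eq_finrank_span_image]
  exact Submodule.finrank_mono (Submodule.span_mono (Set.image_mono (by exact_mod_cast h)))

/-- A set of independent columns inside `T` extends to a column basis of `colSub M T`. -/
theorem exists_extension_card_eq_rank_colSub {m n : ℕ} (M : Matrix (Fin m) (Fin n) ℂ)
    {S T : Finset (Fin n)} (hS : LinearIndepOn ℂ M.col (S : Set (Fin n))) (hST : S ⊆ T) :
    ∃ J : Finset (Fin n), S ⊆ J ∧ J ⊆ T ∧ LinearIndepOn ℂ M.col (J : Set (Fin n)) ∧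
      J.card = (colSub M T).rank := by
  classical
  obtain ⟨b, hbT, hSb, hTb, hb⟩ :=
    exists_linearIndepOn_extension hS (Finset.coe_subset.2 hST)
  lift b to Finset (Fin n) using b.toFinite
  refine ⟨b, by exact_mod_cast hSb, by exact_mod_cast hbT, hb, ?_⟩
  rw [← (linearIndepOn_col_iff_rank_colSub_eq_card M b).1 hb]
  refine le_antisymm (rank_colSub_mono M (by exact_mod_cast hbT)) ?_
  simp only [rank_colSub_eq_finrank_span_image]
  exact Submodule.finrank_mono (Submodule.span_le.2 hTb)

theorem statement_11 {n k : ℕ} (X : Matrix (Fin n) (Fin k) ℂ)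
    (hX : X.rank = k) (S : Finset (Fin n)) :
    IsGreatest ((fun h => (S ∩ h).card) '' Hset X) ((colSub X.transpose S).rank) := by
  have inter_card_le {J : Finset (Fin n)}
      (hJ : LinearIndepOn ℂ X.transpose.col (J : Set (Fin n))) :
      (S ∩ J).card ≤ (colSub X.transpose S).rank := by
    have hSJ : LinearIndepOn ℂ X.transpose.col ((S ∩ J : Finset (Fin n)) : Set (Fin n)) :=
      hJ.mono (by exact_mod_cast Finset.inter_subset_right)
    rw [← (linearIndepOn_col_iff_rank_colSub_eq_card _ _).1 hSJ]
    exact rank_colSub_mono _ Finset.inter_subset_left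
  constructor
  · obtain ⟨I, -, hIS, hI, hIcard⟩ := exists_extension_card_eq_rank_colSub X.transpose
      (S := ∅) (T := S) (by simp) (Finset.empty_subset S)
    obtain ⟨J, hIJ, -, hJ, hJcard⟩ := exists_extension_card_eq_rank_colSub X.transpose
      hI (Finset.subset_univ I)
    have hk : J.card = k := by
      rw [hJcard, rank_colSub_eq_finrank_span_image, Finset.coe_univ, Set.image_univ,
        ← Matrix.rank_eq_finrank_span_cols, Matrix.rank_transpose, hX]
    refine ⟨J, ⟨hk, ?_⟩, le_antisymm (inter_card_le hJ) ?_⟩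
    · rw [(linearIndepOn_col_iff_rank_colSub_eq_card _ _).1 hJ, hk]
    · rw [← hIcard]
      exact Finset.card_le_card (Finset.subset_inter hIS hIJ)
  · rintro _ ⟨J, ⟨hJcard, hJrank⟩, rfl⟩
    exact inter_card_le ((linearIndepOn_col_iff_rank_colSub_eq_card _ _).2
      (hJrank.trans hJcard.symm))
end
end
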